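/- arXiv:1907.01299 — 2 statements merged into one kernel-verified Lean document; each statement's English description precedes it below -/
import Mathlib

section
/- Let G1 and G2 be two arbitrary finite simple connected graphs. Then the Hausdorff distance between G1 and G2 satisfies H(G1, G2) ≤ max{rad(G1), rad(G2)}, where rad denotes the radius of a graph. -/
namespace HDTrees

open SimpleGraph Set

/-- A vertex set `S` is convex in `G`: the induced subgraph is connected and every
shortest path between vertices of `S` stays inside `S`. -/
def ConvexIn {V : Type*} (G : SimpleGraph V) (S : Set V) : Prop :=
  (G.induce S).Connected ∧
    ∀ u ∈ S, ∀ v ∈ S, ∀ p : G.Walk u v, p.length = G.dist u v →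
      ∀ x ∈ p.support, x ∈ S

/-- `A` is an amalgam of `G₁` and `G₂` along the embeddings `f₁`, `f₂`:
the two covers exhaust the vertices and edges of `A`, and the intersection of the
covers corresponds to a convex subgraph on each side. -/
structure IsAmalgam {V₁ V₂ W : Type*} (G₁ : SimpleGraph V₁) (G₂ : SimpleGraph V₂)
    (A : SimpleGraph W) (f₁ : G₁ ↪g A) (f₂ : G₂ ↪g A) : Prop where
  vcover : Set.range ⇑f₁ ∪ Set.range ⇑f₂ = Set.univ
  ecover : ∀ x y : W, A.Adj x y →
    (x ∈ Set.range ⇑f₁ ∧ y ∈ Set.range ⇑f₁) ∨ (x ∈ Set.range ⇑f₂ ∧ y ∈ Set.range ⇑f₂)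
  conv₁ : ConvexIn G₁ (⇑f₁ ⁻¹' Set.range ⇑f₂)
  conv₂ : ConvexIn G₂ (⇑f₂ ⁻¹' Set.range ⇑f₁)

/-- Distance from a vertex to a set of vertices. -/
noncomputable def distToSet {W : Type*} (A : SimpleGraph W) (u : W) (S : Set W) : ℕ :=
  sInf (A.dist u '' S)

/-- The distance between the covers of an amalgam `A` whose intersection has
vertex set `S`: the maximum over vertices of `A` of the distance to `S`. -/
noncomputable def coverDist {W : Type*} (A : SimpleGraph W) (S : Set W) : ℕ :=
  sSup (Set.range fun u => distToSet A u S)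

open scoped Classical in
/-- The Hausdorff distance between two graphs. -/
noncomputable def hausdorffDist {V₁ V₂ : Type*} (G₁ : SimpleGraph V₁)
    (G₂ : SimpleGraph V₂) : ℕ :=
  if Nonempty (G₁ ≃g G₂) then 0
  else sInf {n : ℕ | ∃ (W : Type) (A : SimpleGraph W) (f₁ : G₁ ↪g A) (f₂ : G₂ ↪g A),
    Finite W ∧ IsAmalgam G₁ G₂ A f₁ f₂ ∧
      coverDist A (Set.range ⇑f₁ ∩ Set.range ⇑f₂) = n}

/-- Eccentricity of a vertex. -/
noncomputable def ecc {V : Type*} (G : SimpleGraph V) (v : V) : ℕ := sSup (Set.range (G.dist v))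

/-- Radius of a graph. -/
noncomputable def grad {V : Type*} (G : SimpleGraph V) : ℕ := sInf (Set.range (ecc G))

/-- Diameter of a graph. -/
noncomputable def gdiam {V : Type*} (G : SimpleGraph V) : ℕ := sSup (Set.range (ecc G))

/-- In the tree `T` rooted at `r`, `p` is the parent of `v`. -/
def IsParent {V : Type*} (T : SimpleGraph V) (r p v : V) : Prop :=
  T.Adj v p ∧ T.dist r p + 1 = T.dist r v

/-- The set of children of `v` in the tree `T` rooted at `r`. -/
def childSet {V : Type*} (T : SimpleGraph V) (r v : V) : Set V := {u | IsParent T r v u}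

/-- The vertex set of the subtree rooted at `v` (i.e. `v` and its descendants)
in the tree `T` rooted at `r`. -/
def subtreeSet {V : Type*} (T : SimpleGraph V) (r v : V) : Set V :=
  {u | T.dist r u = T.dist r v + T.dist v u}

lemma mem_subtreeSet_self {V : Type*} (T : SimpleGraph V) (r v : V) :
    v ∈ subtreeSet T r v := by simp [subtreeSet]

/-- The height of the vertex `v` in the tree `T` rooted at `r`. -/
noncomputable def heightV {V : Type*} (T : SimpleGraph V) (r v : V) : ℕ :=
  sSup (T.dist v '' subtreeSet T r v)

/-- The distance between the covers of an optimal top-down amalgam of the rooted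
trees `(T₁, r₁)` and `(T₂, r₂)`: the minimum of the distance between the covers
over all amalgams identifying the two roots. -/
noncomputable def topDownDist {V₁ V₂ : Type*} (T₁ : SimpleGraph V₁) (r₁ : V₁)
    (T₂ : SimpleGraph V₂) (r₂ : V₂) : ℕ :=
  sInf {n : ℕ | ∃ (W : Type) (A : SimpleGraph W) (f₁ : T₁ ↪g A) (f₂ : T₂ ↪g A),
    Finite W ∧ IsAmalgam T₁ T₂ A f₁ f₂ ∧ f₁ r₁ = f₂ r₂ ∧
      coverDist A (Set.range ⇑f₁ ∩ Set.range ⇑f₂) = n}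

/-- `D(x, y)`: the distance between the covers of an optimal top-down amalgam of
the subtree of `(T₁, r₁)` rooted at `x` and the subtree of `(T₂, r₂)` rooted at `y`. -/
noncomputable def subtreeDist {V₁ V₂ : Type*} (T₁ : SimpleGraph V₁) (r₁ : V₁)
    (T₂ : SimpleGraph V₂) (r₂ : V₂) (x : V₁) (y : V₂) : ℕ :=
  topDownDist (T₁.induce (subtreeSet T₁ r₁ x)) ⟨x, mem_subtreeSet_self T₁ r₁ x⟩
    (T₂.induce (subtreeSet T₂ r₂ y)) ⟨y, mem_subtreeSet_self T₂ r₂ y⟩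

/-- `S` is (the vertex set of) a top-down subtree of the tree `T` rooted at `r`. -/
def IsTopDown {V : Type*} (T : SimpleGraph V) (r : V) (S : Set V) : Prop :=
  r ∈ S ∧ ∀ v ∈ S, v ≠ r → ∀ p : V, IsParent T r p v → p ∈ S

/-- `M` is a rooted tree isomorphism (as a set of pairs) between subsets of the rooted
trees `(T₁, r₁)` and `(T₂, r₂)`: it is functional and injective in both coordinates,
matches the roots and maps parents to parents. -/
def IsRootedIso {V₁ V₂ : Type*} (T₁ : SimpleGraph V₁) (r₁ : V₁)
    (T₂ : SimpleGraph V₂) (r₂ : V₂) (M : Set (V₁ × V₂)) : Prop :=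
  (r₁, r₂) ∈ M ∧
  (∀ v w w', (v, w) ∈ M → (v, w') ∈ M → w = w') ∧
  (∀ v v' w, (v, w) ∈ M → (v', w) ∈ M → v = v') ∧
  (∀ v w, (v, w) ∈ M → (v = r₁ ↔ w = r₂)) ∧
  (∀ v w, (v, w) ∈ M → ∀ pv, IsParent T₁ r₁ pv v → ∀ pw, IsParent T₂ r₂ pw w →
    (pv, pw) ∈ M)

/-- The inductive description of the reconstructed mapping `M ⊆ M'`:
`(r₁, r₂) ∈ M`, and a pair of non-root vertices lies in `M` iff it lies in `M'`
and the pair of parents lies in `M`. -/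
def ReconFix {V₁ V₂ : Type*} (T₁ : SimpleGraph V₁) (r₁ : V₁)
    (T₂ : SimpleGraph V₂) (r₂ : V₂) (M' M : Set (V₁ × V₂)) : Prop :=
  ∀ v w, (v, w) ∈ M ↔ ((v, w) ∈ M' ∧
    ((v = r₁ ∧ w = r₂) ∨ (v ≠ r₁ ∧ w ≠ r₂ ∧
      ∃ pv pw, IsParent T₁ r₁ pv v ∧ IsParent T₂ r₂ pw w ∧ (pv, pw) ∈ M)))

lemma convexIn_singleton {V : Type*} (G : SimpleGraph V) (c : V) : ConvexIn G {c} := by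
  refine ⟨⟨.of_subsingleton⟩, ?_⟩
  rintro u rfl v rfl p hp x hx
  rw [dist_self, Walk.length_eq_zero_iff, Walk.nil_iff_support_eq] at hp
  simpa [hp] using hx

lemma dist_le_ecc {V : Type*} [Finite V] (G : SimpleGraph V) (u v : V) :
    G.dist u v ≤ ecc G u :=
  le_csSup (Set.finite_range _).bddAbove ⟨v, rfl⟩

lemma exists_ecc_eq_grad {V : Type*} [Nonempty V] (G : SimpleGraph V) :
    ∃ c, ecc G c = grad G :=
  Nat.sInf_mem (Set.range_nonempty (ecc G))

lemma dist_map_le {V W : Type*} {G : SimpleGraph V} {A : SimpleGraph W} (hG : G.Connected)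
    (f : G →g A) (u v : V) : A.dist (f u) (f v) ≤ G.dist u v := by
  obtain ⟨p, hp⟩ := hG.exists_walk_length_eq_dist u v
  simpa [hp] using dist_le (p.map f)

lemma distToSet_le {W : Type*} (A : SimpleGraph W) (u : W) {w : W} {S : Set W} (hw : w ∈ S) :
    distToSet A u S ≤ A.dist u w :=
  Nat.sInf_le ⟨w, hw, rfl⟩

/-- Two finite graphs can be glued at any pair of base vertices. -/
lemma exists_isAmalgam_wedge {V₁ V₂ : Type*} [Finite V₁] [Finite V₂]
    (G₁ : SimpleGraph V₁) (G₂ : SimpleGraph V₂) (c₁ : V₁) (c₂ : V₂) :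
    ∃ (W : Type) (A : SimpleGraph W) (f₁ : G₁ ↪g A) (f₂ : G₂ ↪g A),
      Finite W ∧ IsAmalgam G₁ G₂ A f₁ f₂ ∧ f₁ c₁ = f₂ c₂ := by
  obtain ⟨n, ⟨e⟩⟩ := Finite.exists_equiv_fin {p : V₁ × V₂ // p.1 = c₁ ∨ p.2 = c₂}
  let φ : Fin n → V₁ × V₂ := fun x => (e.symm x).1
  have hφ : Function.Injective φ := Subtype.val_injective.comp e.symm.injective
  have hmem : ∀ x, (φ x).1 = c₁ ∨ (φ x).2 = c₂ := fun x => (e.symm x).2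
  let A : SimpleGraph (Fin n) := (G₁ □ G₂).comap φ
  let g₁ : V₁ → Fin n := fun v => e ⟨(v, c₂), .inr rfl⟩
  let g₂ : V₂ → Fin n := fun v => e ⟨(c₁, v), .inl rfl⟩
  have hg₁ : ∀ v, φ (g₁ v) = (v, c₂) := fun v => by simp [φ, g₁]
  have hg₂ : ∀ v, φ (g₂ v) = (c₁, v) := fun v => by simp [φ, g₂]
  let f₁ : G₁ ↪g A :=
    { toFun := g₁
      inj' := fun u v h => by simpa [hg₁] using congrArg φ h
      map_rel_iff' := fun {u v} => by
        change (G₁ □ G₂).Adj (φ (g₁ u)) (φ (g₁ v)) ↔ _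
        simp [hg₁, boxProd_adj] }
  let f₂ : G₂ ↪g A :=
    { toFun := g₂
      inj' := fun u v h => by simpa [hg₂] using congrArg φ h
      map_rel_iff' := fun {u v} => by
        change (G₁ □ G₂).Adj (φ (g₂ u)) (φ (g₂ v)) ↔ _
        simp [hg₂, boxProd_adj] }
  have hr₁ : ∀ x, x ∈ Set.range f₁ ↔ (φ x).2 = c₂ := fun x => by
    constructor
    · rintro ⟨v, rfl⟩
      exact congrArg Prod.snd (hg₁ v)
    · intro h
      exact ⟨(φ x).1, hφ ((hg₁ _).trans (Prod.ext rfl h.symm))⟩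
  have hr₂ : ∀ x, x ∈ Set.range f₂ ↔ (φ x).1 = c₁ := fun x => by
    constructor
    · rintro ⟨v, rfl⟩
      exact congrArg Prod.fst (hg₂ v)
    · intro h
      exact ⟨(φ x).2, hφ ((hg₂ _).trans (Prod.ext h.symm rfl))⟩
  refine ⟨Fin n, A, f₁, f₂, inferInstance, ⟨?_, ?_, ?_, ?_⟩,
    hφ ((hg₁ c₁).trans (hg₂ c₂).symm)⟩
  · ext x
    simpa only [Set.mem_union, hr₁, hr₂, Set.mem_univ, iff_true] using (hmem x).symm
  · intro x y h
    simp only [hr₁, hr₂]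
    have hx := hmem x
    have hy := hmem y
    have h' : G₁.Adj (φ x).1 (φ y).1 ∧ (φ x).2 = (φ y).2 ∨
      G₂.Adj (φ x).2 (φ y).2 ∧ (φ x).1 = (φ y).1 := boxProd_adj.mp h
    have h₁ : G₁.Adj (φ x).1 (φ y).1 → (φ x).1 ≠ (φ y).1 := Adj.ne
    have h₂ : G₂.Adj (φ x).2 (φ y).2 → (φ x).2 ≠ (φ y).2 := Adj.ne
    grind
  · have : f₁ ⁻¹' Set.range f₂ = {c₁} := by
      ext v
      rw [Set.mem_preimage, hr₂]
      change (φ (g₁ v)).1 = c₁ ↔ _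
      simp [hg₁]
    exact this ▸ convexIn_singleton G₁ c₁
  · have : f₂ ⁻¹' Set.range f₁ = {c₂} := by
      ext v
      rw [Set.mem_preimage, hr₁]
      change (φ (g₂ v)).2 = c₂ ↔ _
      simp [hg₂]
    exact this ▸ convexIn_singleton G₂ c₂

/-- The Hausdorff distance between two finite simple connected graphs is at
most the maximum of their radii. -/
theorem hausdorffDist_le_max_radius {V₁ V₂ : Type*} [Fintype V₁] [Fintype V₂]
    (G₁ : SimpleGraph V₁) (G₂ : SimpleGraph V₂)
    (h₁ : G₁.Connected) (h₂ : G₂.Connected) :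
    hausdorffDist G₁ G₂ ≤ max (grad G₁) (grad G₂) := by
  unfold hausdorffDist
  split_ifs
  · exact Nat.zero_le _
  have := h₁.nonempty
  have := h₂.nonempty
  obtain ⟨c₁, hc₁⟩ := exists_ecc_eq_grad G₁
  obtain ⟨c₂, hc₂⟩ := exists_ecc_eq_grad G₂
  obtain ⟨W, A, f₁, f₂, hW, hA, hf⟩ := exists_isAmalgam_wedge G₁ G₂ c₁ c₂
  refine le_trans (Nat.sInf_le (m := coverDist A (Set.range f₁ ∩ Set.range f₂))
    ⟨W, A, f₁, f₂, hW, hA, rfl⟩) ?_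
  have : Nonempty W := ⟨f₁ c₁⟩
  refine csSup_le (Set.range_nonempty _) ?_
  rintro _ ⟨x, rfl⟩
  have hc : f₁ c₁ ∈ Set.range f₁ ∩ Set.range f₂ := ⟨⟨c₁, rfl⟩, c₂, hf.symm⟩
  refine (distToSet_le A x hc).trans ?_
  rw [dist_comm]
  obtain ⟨v, rfl⟩ | ⟨v, rfl⟩ : x ∈ Set.range f₁ ∪ Set.range f₂ := hA.vcover ▸ Set.mem_univ x
  · exact (dist_map_le h₁ f₁.toHom c₁ v).trans
      ((dist_le_ecc G₁ c₁ v).trans (hc₁ ▸ le_max_left _ _))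
  · rw [hf]
    exact (dist_map_le h₂ f₂.toHom c₂ v).trans
      ((dist_le_ecc G₂ c₂ v).trans (hc₂ ▸ le_max_right _ _))

end HDTrees
end

section
/- Let T1 and T2 be finite rooted trees, let v be a vertex of T1 and u a vertex of T2, neither of which is a leaf, with children v_1, …, v_p of v and u_1, …, u_q of u, where p ≥ q. For a vertex x, let D(x, y) denote the distance between the covers of an optimal top-down amalgam of the subtree of T1 rooted at x and the subtree of T2 rooted at y, and let height(x) denote the height of x in its tree. Then D(v, u) equals the minimum, over all injections f from {u_1, …, u_q} into {v_1, …, v_p}, of the maximum of: D(f(u_j), u_j) over all j ∈ {1, …, q}, together with height(v_i) + 1 over all children v_i of v not in the image of f. -/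
namespace HDTrees

open SimpleGraph Set

section RootedTree

variable {V : Type*} {T : SimpleGraph V} {r v w a c p q : V}

lemma IsParent.exists_of_ne (hT : T.IsTree) (h : a ≠ w) : ∃ c, IsParent T w c a := by
  obtain ⟨p, hp⟩ := hT.connected.exists_walk_length_eq_dist a w
  cases p with
  | nil => exact absurd rfl h
  | @cons _ c _ hac q =>
    refine ⟨c, hac, ?_⟩
    have h₁ := dist_le q
    have h₂ := hT.connected.dist_triangle (u := w) (v := c) (w := a)
    have h₃ : T.dist c a = 1 := dist_eq_one_iff_adj.2 hac.symm
    rw [Walk.length_cons, dist_comm] at hp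
    rw [dist_comm] at h₁
    omega

lemma IsParent.unique (hT : T.IsTree) (hp : IsParent T r p a) (hq : IsParent T r q a) :
    p = q := by
  have key : ∀ {p : V}, IsParent T r p a →
      ∃ W : T.Walk r a, W.IsPath ∧ W.penultimate = p := by
    intro p hp
    obtain ⟨W, hW⟩ := hT.connected.exists_walk_length_eq_dist r p
    refine ⟨W.concat hp.1.symm, Walk.isPath_of_length_eq_dist _ ?_, by simp⟩
    rw [Walk.length_concat, hW, hp.2]
  obtain ⟨W₁, hW₁, h₁⟩ := key hp
  obtain ⟨W₂, hW₂, h₂⟩ := key hq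
  rw [← h₁, ← h₂, (hT.existsUnique_path r a).unique hW₁ hW₂]

lemma IsParent.dist_eq_one (h : IsParent T r p a) : T.dist p a = 1 :=
  dist_eq_one_iff_adj.2 h.1.symm

lemma isParent_or_isParent_of_adj (hT : T.IsTree) (r : V) (h : T.Adj a c) :
    IsParent T r a c ∨ IsParent T r c a := by
  rcases hT.dist_eq_dist_add_one_of_adj r h with h' | h'
  · exact Or.inr ⟨h, h'.symm⟩
  · exact Or.inl ⟨h.symm, h'.symm⟩

lemma IsParent.mem_subtreeSet (hT : T.IsTree) (h : IsParent T r p a)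
    (hp : p ∈ subtreeSet T r w) : a ∈ subtreeSet T r w := by
  have h₁ := hT.connected.dist_triangle (u := w) (v := p) (w := a)
  have h₂ := hT.connected.dist_triangle (u := r) (v := w) (w := a)
  have h₃ := h.dist_eq_one
  have h₄ := h.2
  simp only [subtreeSet, Set.mem_ofPred_eq] at *
  omega

lemma IsParent.of_subtreeSet (hT : T.IsTree) (h : IsParent T w p a)
    (ha : a ∈ subtreeSet T r w) : IsParent T r p a ∧ p ∈ subtreeSet T r w := by
  have h₁ := hT.connected.dist_triangle (u := r) (v := w) (w := p)
  have h₂ := hT.connected.dist_triangle (u := r) (v := p) (w := a)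
  have h₃ := h.dist_eq_one
  have h₄ := h.2
  simp only [subtreeSet, Set.mem_ofPred_eq] at *
  exact ⟨⟨h.1, by omega⟩, by omega⟩

lemma IsParent.parent_mem_subtreeSet (hT : T.IsTree) (h : IsParent T r p a)
    (ha : a ∈ subtreeSet T r w) (hne : a ≠ w) : p ∈ subtreeSet T r w := by
  obtain ⟨c, hc⟩ := IsParent.exists_of_ne hT hne
  obtain ⟨hc₁, hc₂⟩ := hc.of_subtreeSet hT ha
  rwa [h.unique hT hc₁]

lemma not_mem_subtreeSet_of_dist_le (hT : T.IsTree) (hne : a ≠ w)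
    (h : T.dist r a ≤ T.dist r w) : a ∉ subtreeSet T r w := by
  intro ha
  have := hT.connected.pos_dist_of_ne hne.symm
  simp only [subtreeSet, Set.mem_ofPred_eq] at ha
  omega

lemma IsParent.not_mem_subtreeSet (hT : T.IsTree) (h : IsParent T r p a) :
    p ∉ subtreeSet T r a :=
  not_mem_subtreeSet_of_dist_le hT h.1.ne.symm (by have := h.2; omega)

lemma dist_add_one_le_of_mem_subtreeSet (hT : T.IsTree) (ha : a ∈ subtreeSet T r w)
    (hc : c ∉ subtreeSet T r w) : T.dist a w + 1 ≤ T.dist a c := by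
  obtain ⟨W, hW⟩ := hT.connected.exists_walk_length_eq_dist a c
  rw [← hW]
  clear hW
  induction W with
  | nil => exact absurd ha hc
  | @cons a b c hab W ih =>
    rw [Walk.length_cons]
    by_cases hb : b ∈ subtreeSet T r w
    · have h₁ := ih hb hc
      have h₂ := hT.connected.dist_triangle (u := a) (v := b) (w := w)
      have h₃ : T.dist a b = 1 := dist_eq_one_iff_adj.2 hab
      omega
    · have : a = w := by
        by_contra hne
        rcases isParent_or_isParent_of_adj hT r hab with h | h
        · exact hb (h.mem_subtreeSet hT ha)
        · exact hb (h.parent_mem_subtreeSet hT ha hne)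
      subst this
      simp

lemma eq_or_exists_child_of_mem_subtreeSet (hT : T.IsTree) (ha : a ∈ subtreeSet T r v) :
    a = v ∨ ∃ w ∈ childSet T r v, a ∈ subtreeSet T r w := by
  induction hn : T.dist r a using Nat.strong_induction_on generalizing a with
  | _ n ih =>
    refine or_iff_not_imp_left.2 fun hne => ?_
    obtain ⟨c, hc⟩ := IsParent.exists_of_ne hT hne
    obtain ⟨hc, hcv⟩ := hc.of_subtreeSet hT ha
    rcases ih (T.dist r c) (by have := hc.2; omega) hcv rfl with h | ⟨w, hw, hcw⟩
    · exact ⟨a, (h ▸ hc : IsParent T r v a), mem_subtreeSet_self T r a⟩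
    · exact ⟨w, hw, hc.mem_subtreeSet hT hcw⟩

lemma eq_of_mem_subtreeSet_of_isParent (hT : T.IsTree) (hp : IsParent T r v p)
    (hq : IsParent T r v q) (h₁ : a ∈ subtreeSet T r p) (h₂ : a ∈ subtreeSet T r q) :
    p = q := by
  by_contra hne
  have hd : T.dist r p = T.dist r q := hp.2.symm.trans hq.2
  have := dist_add_one_le_of_mem_subtreeSet hT h₁
    (not_mem_subtreeSet_of_dist_le hT (Ne.symm hne) hd.ge)
  have := dist_add_one_le_of_mem_subtreeSet hT h₂
    (not_mem_subtreeSet_of_dist_le hT hne hd.le)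
  omega

lemma heightV_le_iff [Finite V] {n : ℕ} :
    heightV T r w ≤ n ↔ ∀ a ∈ subtreeSet T r w, T.dist w a ≤ n := by
  unfold heightV
  have hne : (T.dist w '' subtreeSet T r w).Nonempty := ⟨_, w, mem_subtreeSet_self T r w, rfl⟩
  rw [csSup_le_iff (Set.toFinite _).bddAbove hne]
  simp

lemma connected_induce_of_descent {S : Set V} (hr : r ∈ S)
    (hS : ∀ a ∈ S, a = r ∨ ∃ c ∈ S, IsParent T r c a) : (T.induce S).Connected := by
  rw [connected_iff_exists_forall_reachable]
  refine ⟨⟨r, hr⟩, fun ⟨a, ha⟩ => ?_⟩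
  induction hn : T.dist r a using Nat.strong_induction_on generalizing a with
  | _ n ih =>
    rcases hS a ha with rfl | ⟨c, hc, hca⟩
    · rfl
    · refine (ih (T.dist r c) (by have := hca.2; omega) c hc rfl).trans (Adj.reachable ?_)
      exact hca.1.symm

lemma convexIn_of_connected (hT : T.IsTree) {S : Set V} (hS : (T.induce S).Connected) :
    ConvexIn T S := by
  refine ⟨hS, fun a ha b hb W hW x hx => ?_⟩
  obtain ⟨Q, hQ⟩ := (hS ⟨a, ha⟩ ⟨b, hb⟩).exists_isPath
  have hQ' : (Q.map (Embedding.induce S).toHom).IsPath :=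
    hQ.map (Embedding.induce (G := T) S).injective
  rw [(hT.existsUnique_path a b).unique (W.isPath_of_length_eq_dist hW) hQ'] at hx
  obtain ⟨y, -, rfl⟩ :=
    List.mem_map.1 ((congrArg (x ∈ ·) (Walk.support_map (Embedding.induce S).toHom Q)).mp hx)
  exact y.2

lemma convexIn_subtreeSet (hT : T.IsTree) : ConvexIn T (subtreeSet T r w) := by
  refine convexIn_of_connected hT
    (connected_induce_of_descent (r := w) (mem_subtreeSet_self T r w) fun a ha => ?_)
  refine or_iff_not_imp_left.2 fun hne => ?_
  obtain ⟨c, hc⟩ := IsParent.exists_of_ne hT hne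
  exact ⟨c, (hc.of_subtreeSet hT ha).2, hc⟩

lemma ConvexIn.dist_induce (hT : T.Connected) {S : Set V} (hS : ConvexIn T S) (a b : S) :
    (T.induce S).dist a b = T.dist a b := by
  apply le_antisymm
  · obtain ⟨W, hW⟩ := hT.exists_walk_length_eq_dist (a : V) b
    have h := dist_le (W.induce S (hS.2 a a.2 b b.2 W hW))
    have h' := congrArg Walk.length (W.map_induce (hS.2 a a.2 b b.2 W hW))
    rw [Walk.length_map] at h'
    exact h.trans (h'.trans hW).le
  · obtain ⟨W, hW⟩ := hS.1.exists_walk_length_eq_dist a b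
    rw [← hW, ← Walk.length_map (Embedding.induce S).toHom]
    exact dist_le _

lemma isTree_induce_subtreeSet (hT : T.IsTree) : (T.induce (subtreeSet T r w)).IsTree :=
  ⟨(convexIn_subtreeSet hT).1, hT.isAcyclic.induce _⟩

lemma isParent_induce_iff (hT : T.IsTree) (p a : subtreeSet T r w) :
    IsParent (T.induce (subtreeSet T r w)) ⟨w, mem_subtreeSet_self T r w⟩ p a ↔
      IsParent T r p a := by
  have hp := p.2
  have ha := a.2
  simp only [subtreeSet, Set.mem_ofPred_eq] at hp ha
  simp only [IsParent, (convexIn_subtreeSet hT).dist_induce hT.connected, comap_adj,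
    Function.Embedding.subtype_apply]
  refine and_congr_right fun _ => ?_
  omega

end RootedTree

/-- `M` is the graph of a rooted isomorphism between top-down subtrees of the subtrees of
`(T₁, r₁)` and `(T₂, r₂)` rooted at `x` and `y`, such that every vertex of these two subtrees
is at distance at most `n` from a matched vertex. -/
structure IsTopDownMatching {V₁ V₂ : Type*} (T₁ : SimpleGraph V₁) (r₁ : V₁)
    (T₂ : SimpleGraph V₂) (r₂ : V₂) (x : V₁) (y : V₂) (M : V₁ → V₂ → Prop) (n : ℕ) : Prop where
  root : M x y
  mem₁ : ∀ a b, M a b → a ∈ subtreeSet T₁ r₁ x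
  mem₂ : ∀ a b, M a b → b ∈ subtreeSet T₂ r₂ y
  right_unique : ∀ a b b', M a b → M a b' → b = b'
  left_unique : ∀ a a' b, M a b → M a' b → a = a'
  parent : ∀ a b, M a b → (a = x ∧ b = y) ∨
    ∃ a' b', M a' b' ∧ IsParent T₁ r₁ a' a ∧ IsParent T₂ r₂ b' b
  near₁ : ∀ a ∈ subtreeSet T₁ r₁ x, ∃ s t, M s t ∧ T₁.dist a s ≤ n
  near₂ : ∀ b ∈ subtreeSet T₂ r₂ y, ∃ s t, M s t ∧ T₂.dist b t ≤ n

namespace IsTopDownMatching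

variable {V₁ V₂ : Type*} {T₁ : SimpleGraph V₁} {r₁ : V₁} {T₂ : SimpleGraph V₂} {r₂ : V₂}
  {x : V₁} {y : V₂} {M : V₁ → V₂ → Prop} {n : ℕ}

lemma symm (h : IsTopDownMatching T₁ r₁ T₂ r₂ x y M n) :
    IsTopDownMatching T₂ r₂ T₁ r₁ y x (fun b a => M a b) n where
  root := h.root
  mem₁ b a hM := h.mem₂ a b hM
  mem₂ b a hM := h.mem₁ a b hM
  right_unique b a a' hM hM' := h.left_unique a a' b hM hM'
  left_unique b b' a hM hM' := h.right_unique a b b' hM hM'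
  parent b a hM := by
    rcases h.parent a b hM with ⟨h₁, h₂⟩ | ⟨a', b', h₁, h₂, h₃⟩
    · exact Or.inl ⟨h₂, h₁⟩
    · exact Or.inr ⟨b', a', h₁, h₃, h₂⟩
  near₁ b hb := by
    obtain ⟨s, t, h₁, h₂⟩ := h.near₂ b hb
    exact ⟨t, s, h₁, h₂⟩
  near₂ a ha := by
    obtain ⟨s, t, h₁, h₂⟩ := h.near₁ a ha
    exact ⟨t, s, h₁, h₂⟩

lemma singleton (h₁ : ∀ a ∈ subtreeSet T₁ r₁ x, T₁.dist a x ≤ n)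
    (h₂ : ∀ b ∈ subtreeSet T₂ r₂ y, T₂.dist b y ≤ n) :
    IsTopDownMatching T₁ r₁ T₂ r₂ x y (fun a b => a = x ∧ b = y) n where
  root := ⟨rfl, rfl⟩
  mem₁ := by rintro a b ⟨rfl, rfl⟩; exact mem_subtreeSet_self T₁ r₁ a
  mem₂ := by rintro a b ⟨rfl, rfl⟩; exact mem_subtreeSet_self T₂ r₂ b
  right_unique := by rintro a b b' ⟨_, rfl⟩ ⟨_, rfl⟩; rfl
  left_unique := by rintro a b b' ⟨rfl, _⟩ ⟨rfl, _⟩; rfl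
  parent a b h := Or.inl h
  near₁ a ha := ⟨x, y, ⟨rfl, rfl⟩, h₁ a ha⟩
  near₂ b hb := ⟨x, y, ⟨rfl, rfl⟩, h₂ b hb⟩

lemma exists_of_finite [Finite V₁] [Finite V₂] (T₁ : SimpleGraph V₁) (r₁ : V₁)
    (T₂ : SimpleGraph V₂) (r₂ : V₂) (x : V₁) (y : V₂) :
    ∃ n M, IsTopDownMatching T₁ r₁ T₂ r₂ x y M n := by
  obtain ⟨n₁, h₁⟩ := (Set.finite_range fun a => T₁.dist a x).bddAbove
  obtain ⟨n₂, h₂⟩ := (Set.finite_range fun b => T₂.dist b y).bddAbove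
  exact ⟨max n₁ n₂, _, singleton
    (fun a _ => (h₁ ⟨a, rfl⟩).trans (le_max_left _ _))
    (fun b _ => (h₂ ⟨b, rfl⟩).trans (le_max_right _ _))⟩

section Descent

variable {a w : V₁} {b w' : V₂}

/-- Matching the parent of `a` with the parent of `b`. -/
lemma exists_parent (h : IsTopDownMatching T₁ r₁ T₂ r₂ x y M n) (hM : M a b) (ha : a ≠ x) :
    ∃ a' b', M a' b' ∧ IsParent T₁ r₁ a' a ∧ IsParent T₂ r₂ b' b :=
  (h.parent a b hM).resolve_left fun h' => ha h'.1

lemma mem_subtreeSet_right (h : IsTopDownMatching T₁ r₁ T₂ r₂ x y M n) (h₁ : T₁.IsTree)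
    (h₂ : T₂.IsTree) (hw : M w w') (hM : M a b) (ha : a ∈ subtreeSet T₁ r₁ w) :
    b ∈ subtreeSet T₂ r₂ w' := by
  induction hk : T₁.dist r₁ a using Nat.strong_induction_on generalizing a b with
  | _ k ih =>
    by_cases haw : a = w
    · subst haw
      rw [h.right_unique a b w' hM hw]
      exact mem_subtreeSet_self T₂ r₂ w'
    · have hax : a ≠ x := by
        rintro rfl
        refine not_mem_subtreeSet_of_dist_le h₁ haw ?_ ha
        have := h.mem₁ w w' hw
        simp only [subtreeSet, Set.mem_ofPred_eq] at this
        omega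
      obtain ⟨a', b', hM', ha', hb'⟩ := h.exists_parent hM hax
      exact hb'.mem_subtreeSet h₂ (ih (T₁.dist r₁ a') (by have := ha'.2; omega) hM'
        (ha'.parent_mem_subtreeSet h₁ ha haw) rfl)

lemma not_mem_subtreeSet_of_unmatched (h : IsTopDownMatching T₁ r₁ T₂ r₂ x y M n)
    (h₁ : T₁.IsTree) (hw : IsParent T₁ r₁ x w) (hun : ∀ t, ¬ M w t) (hM : M a b) :
    a ∉ subtreeSet T₁ r₁ w := by
  induction hk : T₁.dist r₁ a using Nat.strong_induction_on generalizing a b with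
  | _ k ih =>
    intro ha
    have haw : a ≠ w := by rintro rfl; exact hun b hM
    have hax : a ≠ x := by rintro rfl; exact hw.not_mem_subtreeSet h₁ ha
    obtain ⟨a', b', hM', ha', -⟩ := h.exists_parent hM hax
    exact ih (T₁.dist r₁ a') (by have := ha'.2; omega) hM' rfl
      (ha'.parent_mem_subtreeSet h₁ ha haw)

lemma dist_add_one_le_of_unmatched (h : IsTopDownMatching T₁ r₁ T₂ r₂ x y M n)
    (h₁ : T₁.IsTree) (hw : IsParent T₁ r₁ x w) (hun : ∀ t, ¬ M w t)
    (ha : a ∈ subtreeSet T₁ r₁ w) : T₁.dist a w + 1 ≤ n := by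
  have hax : a ∈ subtreeSet T₁ r₁ x := by
    have h₃ := h₁.connected.dist_triangle (u := x) (v := w) (w := a)
    have h₄ := h₁.connected.dist_triangle (u := r₁) (v := x) (w := a)
    have h₅ := hw.dist_eq_one
    have h₆ := hw.2
    simp only [subtreeSet, Set.mem_ofPred_eq] at *
    omega
  obtain ⟨s, t, hM, hs⟩ := h.near₁ a hax
  exact (dist_add_one_le_of_mem_subtreeSet h₁ ha
    (h.not_mem_subtreeSet_of_unmatched h₁ hw hun hM)).trans hs

lemma near_restrict (h : IsTopDownMatching T₁ r₁ T₂ r₂ x y M n) (h₁ : T₁.IsTree)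
    (h₂ : T₂.IsTree) (hw : M w w') (ha : a ∈ subtreeSet T₁ r₁ w) :
    ∃ s t, (M s t ∧ s ∈ subtreeSet T₁ r₁ w ∧ t ∈ subtreeSet T₂ r₂ w') ∧ T₁.dist a s ≤ n := by
  have hwx := h.mem₁ w w' hw
  have hax : a ∈ subtreeSet T₁ r₁ x := by
    have h₃ := h₁.connected.dist_triangle (u := x) (v := w) (w := a)
    have h₄ := h₁.connected.dist_triangle (u := r₁) (v := x) (w := a)
    simp only [subtreeSet, Set.mem_ofPred_eq] at *
    omega
  obtain ⟨s, t, hM, hs⟩ := h.near₁ a hax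
  by_cases hsw : s ∈ subtreeSet T₁ r₁ w
  · exact ⟨s, t, ⟨hM, hsw, h.mem_subtreeSet_right h₁ h₂ hw hM hsw⟩, hs⟩
  · refine ⟨w, w', ⟨hw, mem_subtreeSet_self T₁ r₁ w, mem_subtreeSet_self T₂ r₂ w'⟩, ?_⟩
    have := dist_add_one_le_of_mem_subtreeSet h₁ ha hsw
    omega

lemma restrict (h : IsTopDownMatching T₁ r₁ T₂ r₂ x y M n) (h₁ : T₁.IsTree)
    (h₂ : T₂.IsTree) (hw : M w w') :
    IsTopDownMatching T₁ r₁ T₂ r₂ w w'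
      (fun a b => M a b ∧ a ∈ subtreeSet T₁ r₁ w ∧ b ∈ subtreeSet T₂ r₂ w') n where
  root := ⟨hw, mem_subtreeSet_self T₁ r₁ w, mem_subtreeSet_self T₂ r₂ w'⟩
  mem₁ a b hM := hM.2.1
  mem₂ a b hM := hM.2.2
  right_unique a b b' hM hM' := h.right_unique a b b' hM.1 hM'.1
  left_unique a a' b hM hM' := h.left_unique a a' b hM.1 hM'.1
  parent a b hM := by
    by_cases haw : a = w
    · subst haw
      exact Or.inl ⟨rfl, h.right_unique a b w' hM.1 hw⟩
    · have hbw : b ≠ w' := by rintro rfl; exact haw (h.left_unique a w b hM.1 hw)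
      rcases h.parent a b hM.1 with ⟨rfl, rfl⟩ | ⟨a', b', hM', ha', hb'⟩
      · exfalso
        refine not_mem_subtreeSet_of_dist_le h₁ haw ?_ hM.2.1
        have := h.mem₁ w w' hw
        simp only [subtreeSet, Set.mem_ofPred_eq] at this
        omega
      · exact Or.inr ⟨a', b', ⟨hM', ha'.parent_mem_subtreeSet h₁ hM.2.1 haw,
          hb'.parent_mem_subtreeSet h₂ hM.2.2 hbw⟩, ha', hb'⟩
  near₁ a ha := h.near_restrict h₁ h₂ hw ha
  near₂ b hb := by
    obtain ⟨t, s, ⟨hM, ht, hs⟩, hd⟩ := h.symm.near_restrict h₂ h₁ hw hb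
    exact ⟨s, t, ⟨hM, hs, ht⟩, hd⟩

/-- A vertex matched with a child of `y` is a child of `x`. -/
lemma isParent_of_isParent (h : IsTopDownMatching T₁ r₁ T₂ r₂ x y M n) (h₂ : T₂.IsTree)
    (hb : IsParent T₂ r₂ y b) (hM : M a b) : IsParent T₁ r₁ x a := by
  rcases h.parent a b hM with ⟨rfl, rfl⟩ | ⟨a', b', hM', ha', hb'⟩
  · exact absurd rfl hb.1.ne
  · obtain rfl := hb.unique h₂ hb'
    rwa [← h.left_unique a' x y hM' h.root]

end Descent

end IsTopDownMatching

section Children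

variable {V₁ V₂ : Type*} {T₁ : SimpleGraph V₁} {r₁ : V₁} {T₂ : SimpleGraph V₂} {r₂ : V₂}
  {v : V₁} {u : V₂} {n : ℕ}

lemma IsTopDownMatching.glue (h₁ : T₁.IsTree) (h₂ : T₂.IsTree)
    {f : childSet T₂ r₂ u → childSet T₁ r₁ v} (hf : Function.Injective f)
    {N : childSet T₂ r₂ u → V₁ → V₂ → Prop}
    (hN : ∀ j, IsTopDownMatching T₁ r₁ T₂ r₂ (f j) j (N j) n)
    (hn : ∀ i ∉ Set.range f, ∀ a ∈ subtreeSet T₁ r₁ (i : V₁), T₁.dist i a + 1 ≤ n) :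
    IsTopDownMatching T₁ r₁ T₂ r₂ v u (fun a b => (a = v ∧ b = u) ∨ ∃ j, N j a b) n where
  root := Or.inl ⟨rfl, rfl⟩
  mem₁ := by
    rintro a b (⟨rfl, rfl⟩ | ⟨j, hj⟩)
    · exact mem_subtreeSet_self T₁ r₁ a
    · have hv := (f j).2.mem_subtreeSet h₁ (mem_subtreeSet_self T₁ r₁ v)
      have ha := (hN j).mem₁ a b hj
      have := h₁.connected.dist_triangle (u := v) (v := f j) (w := a)
      have := h₁.connected.dist_triangle (u := r₁) (v := v) (w := a)
      simp only [subtreeSet, Set.mem_ofPred_eq] at *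
      omega
  mem₂ := by
    rintro a b (⟨rfl, rfl⟩ | ⟨j, hj⟩)
    · exact mem_subtreeSet_self T₂ r₂ b
    · have hu := j.2.mem_subtreeSet h₂ (mem_subtreeSet_self T₂ r₂ u)
      have hb := (hN j).mem₂ a b hj
      have := h₂.connected.dist_triangle (u := u) (v := j) (w := b)
      have := h₂.connected.dist_triangle (u := r₂) (v := u) (w := b)
      simp only [subtreeSet, Set.mem_ofPred_eq] at *
      omega
  right_unique := by
    rintro a b b' (⟨rfl, rfl⟩ | ⟨j, hj⟩) (⟨ha, rfl⟩ | ⟨j', hj'⟩)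
    · rfl
    · exact absurd ((hN j').mem₁ _ _ hj') (IsParent.not_mem_subtreeSet h₁ (f j').2)
    · subst ha
      exact absurd ((hN j).mem₁ _ _ hj) (IsParent.not_mem_subtreeSet h₁ (f j).2)
    · obtain rfl : j = j' := hf <| Subtype.ext <| eq_of_mem_subtreeSet_of_isParent h₁ (f j).2
        (f j').2 ((hN j).mem₁ _ _ hj) ((hN j').mem₁ _ _ hj')
      exact (hN j).right_unique a b b' hj hj'
  left_unique := by
    rintro a a' b (⟨rfl, rfl⟩ | ⟨j, hj⟩) (⟨rfl, hb⟩ | ⟨j', hj'⟩)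
    · rfl
    · exact absurd ((hN j').mem₂ _ _ hj') (IsParent.not_mem_subtreeSet h₂ j'.2)
    · subst hb
      exact absurd ((hN j).mem₂ _ _ hj) (IsParent.not_mem_subtreeSet h₂ j.2)
    · obtain rfl : j = j' := Subtype.ext <| eq_of_mem_subtreeSet_of_isParent h₂ j.2
        j'.2 ((hN j).mem₂ _ _ hj) ((hN j').mem₂ _ _ hj')
      exact (hN j).left_unique a a' b hj hj'
  parent := by
    rintro a b (h | ⟨j, hj⟩)
    · exact Or.inl h
    · rcases (hN j).parent a b hj with ⟨rfl, rfl⟩ | ⟨a', b', hM, ha, hb⟩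
      · exact Or.inr ⟨v, u, Or.inl ⟨rfl, rfl⟩, (f j).2, j.2⟩
      · exact Or.inr ⟨a', b', Or.inr ⟨j, hM⟩, ha, hb⟩
  near₁ a ha := by
    rcases eq_or_exists_child_of_mem_subtreeSet h₁ ha with rfl | ⟨w, hw, haw⟩
    · exact ⟨a, u, Or.inl ⟨rfl, rfl⟩, by simp⟩
    · by_cases hr : (⟨w, hw⟩ : childSet T₁ r₁ v) ∈ Set.range f
      · obtain ⟨j, hj⟩ := hr
        have hjw : (f j : V₁) = w := congrArg Subtype.val hj
        obtain ⟨s, t, hM, hs⟩ := (hN j).near₁ a (hjw ▸ haw)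
        exact ⟨s, t, Or.inr ⟨j, hM⟩, hs⟩
      · refine ⟨v, u, Or.inl ⟨rfl, rfl⟩, ?_⟩
        have h₃ := hn _ hr a haw
        have h₄ := h₁.connected.dist_triangle (u := v) (v := w) (w := a)
        have h₅ := IsParent.dist_eq_one hw
        rw [SimpleGraph.dist_comm]
        dsimp only at h₃
        omega
  near₂ b hb := by
    rcases eq_or_exists_child_of_mem_subtreeSet h₂ hb with rfl | ⟨w, hw, hbw⟩
    · exact ⟨v, b, Or.inl ⟨rfl, rfl⟩, by simp⟩
    · obtain ⟨s, t, hM, hs⟩ := (hN ⟨w, hw⟩).near₂ b hbw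
      exact ⟨s, t, Or.inr ⟨⟨w, hw⟩, hM⟩, hs⟩

lemma exists_injective_extending {α β : Type*} [Finite α] [Finite β]
    (h : Nat.card α ≤ Nat.card β) {R : β → α → Prop}
    (hr : ∀ b a a', R b a → R b a' → a = a') (hl : ∀ b b' a, R b a → R b' a → b = b') :
    ∃ f : α → β, Function.Injective f ∧ ∀ b a, R b a → f a = b := by
  classical
  have := Fintype.ofFinite α
  have := Fintype.ofFinite β
  rcases isEmpty_or_nonempty α with hα | ⟨⟨a₀⟩⟩
  · exact ⟨hα.elim, fun a => hα.elim a, fun _ a => hα.elim a⟩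
  have : Nonempty β := by
    rw [← Finite.card_pos_iff]
    exact (Finite.card_pos_iff.2 ⟨a₀⟩).trans_le h
  let s : Finset α := {a | ∃ b, R b a}
  let g : α → β := fun a => Classical.epsilon fun b => R b a
  have hg : ∀ a ∈ s, R (g a) a := fun a ha =>
    Classical.epsilon_spec (p := fun b => R b a) (Finset.mem_filter.1 ha).2
  have hinj : Set.InjOn g s := fun a ha a' ha' he => hr (g a) a a' (hg a ha) (he ▸ hg a' ha')
  obtain ⟨t, hst, -, ht⟩ := Finset.exists_subsuperset_card_eq
    (Finset.subset_univ (s.image g)) (n := Fintype.card α)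
    (by rw [Finset.card_image_of_injOn hinj]; exact Finset.card_le_univ s)
    (by simpa [Nat.card_eq_fintype_card] using h)
  obtain ⟨e, he⟩ := Finset.exists_equiv_extend_of_card_eq ht.symm hst hinj
  refine ⟨fun a => e a, Subtype.val_injective.comp e.injective, fun b a hba => ?_⟩
  have ha : a ∈ s := by simpa [s] using ⟨b, hba⟩
  exact (he a ha).trans (hl _ _ a (hg a ha) hba)

theorem exists_isTopDownMatching_iff [Finite V₁] [Finite V₂] (h₁ : T₁.IsTree) (h₂ : T₂.IsTree)
    (hcard : (childSet T₂ r₂ u).ncard ≤ (childSet T₁ r₁ v).ncard) :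
    (∃ M, IsTopDownMatching T₁ r₁ T₂ r₂ v u M n) ↔
      ∃ f : childSet T₂ r₂ u → childSet T₁ r₁ v, Function.Injective f ∧
        (∀ j, ∃ M, IsTopDownMatching T₁ r₁ T₂ r₂ (f j) j M n) ∧
        ∀ i ∉ Set.range f, heightV T₁ r₁ i + 1 ≤ n := by
  constructor
  · rintro ⟨M, hM⟩
    obtain ⟨f, hf, hfM⟩ := exists_injective_extending
      (α := childSet T₂ r₂ u) (β := childSet T₁ r₁ v) hcard (R := fun a b => M a b)
      (fun b a a' h h' => Subtype.ext (hM.right_unique b a a' h h'))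
      (fun b b' a h h' => Subtype.ext (hM.left_unique b b' a h h'))
    have hun : ∀ i : childSet T₁ r₁ v, (∀ j : childSet T₂ r₂ u, M i j → i ≠ f j) → ∀ t, ¬ M i t := by
      intro i hi t ht
      have ht' : t ∈ childSet T₂ r₂ u := hM.symm.isParent_of_isParent h₁ i.2 ht
      exact hi ⟨t, ht'⟩ ht (hfM i ⟨t, ht'⟩ ht).symm
    refine ⟨f, hf, fun j => ?_, fun i hi => ?_⟩
    · by_cases hj : M (f j) j
      · exact ⟨_, hM.restrict h₁ h₂ hj⟩
      · refine ⟨_, IsTopDownMatching.singleton (fun a ha => ?_) fun b hb => ?_⟩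
        · have := hM.dist_add_one_le_of_unmatched h₁ (f j).2
            (hun _ fun j' hj' he => hj (by rwa [← hf he] at hj')) ha
          omega
        · have := hM.symm.dist_add_one_le_of_unmatched h₂ j.2 (fun t ht => hj ?_) hb
          · omega
          · have ht' : t ∈ childSet T₁ r₁ v := hM.isParent_of_isParent h₂ j.2 ht
            rwa [hfM ⟨t, ht'⟩ j ht]
    · have key : ∀ a ∈ subtreeSet T₁ r₁ (i : V₁), T₁.dist i a + 1 ≤ n := fun a ha => by
        rw [SimpleGraph.dist_comm]
        exact hM.dist_add_one_le_of_unmatched h₁ i.2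
          (hun i fun j _ he => hi ⟨j, he.symm⟩) ha
      have := key i (mem_subtreeSet_self T₁ r₁ i)
      have := heightV_le_iff.2 fun a ha => Nat.le_sub_one_of_lt (key a ha)
      omega
  · rintro ⟨f, hf, hM, hn⟩
    choose N hN using hM
    refine ⟨_, IsTopDownMatching.glue h₁ h₂ hf hN fun i hi a ha => ?_⟩
    have := heightV_le_iff.1 le_rfl a ha
    have := hn i hi
    omega

end Children

section Amalgam

variable {V₁ V₂ W : Type*} {T₁ : SimpleGraph V₁} {r₁ : V₁} {T₂ : SimpleGraph V₂} {r₂ : V₂}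
  {A : SimpleGraph W} {f₁ : T₁ ↪g A} {f₂ : T₂ ↪g A} {n : ℕ}

lemma subtreeSet_root (T : SimpleGraph V₁) (r : V₁) : subtreeSet T r r = Set.univ := by
  ext
  simp [subtreeSet]

lemma IsAmalgam.symm (h : IsAmalgam T₁ T₂ A f₁ f₂) : IsAmalgam T₂ T₁ A f₂ f₁ where
  vcover := by rw [Set.union_comm, h.vcover]
  ecover x y hxy := (h.ecover x y hxy).symm
  conv₁ := h.conv₂
  conv₂ := h.conv₁

lemma IsAmalgam.exists_parent (h : IsAmalgam T₁ T₂ A f₁ f₂) (h₁ : T₁.IsTree)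
    (hr : f₁ r₁ = f₂ r₂) {a : V₁} {b : V₂} (hab : f₁ a = f₂ b) (ha : a ≠ r₁) :
    ∃ a' b', f₁ a' = f₂ b' ∧ IsParent T₁ r₁ a' a ∧ T₂.Adj b b' := by
  obtain ⟨c, hc⟩ := IsParent.exists_of_ne h₁ ha
  obtain ⟨p, hp⟩ := h₁.connected.exists_walk_length_eq_dist r₁ c
  obtain ⟨d, hd⟩ : c ∈ ⇑f₁ ⁻¹' Set.range ⇑f₂ := by
    refine h.conv₁.2 r₁ ⟨r₂, hr.symm⟩ a ⟨b, hab.symm⟩ (p.concat hc.1.symm) ?_ c ?_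
    · rw [Walk.length_concat, hp, hc.2]
    · simp [Walk.support_concat]
  refine ⟨c, d, hd.symm, hc, ?_⟩
  rw [← f₂.map_adj_iff, hd, ← hab, f₁.map_adj_iff]
  exact hc.1

lemma IsAmalgam.dist_le (h : IsAmalgam T₁ T₂ A f₁ f₂) (h₁ : T₁.IsTree) (h₂ : T₂.IsTree)
    (hr : f₁ r₁ = f₂ r₂) {a : V₁} {b : V₂} (hab : f₁ a = f₂ b) :
    T₂.dist r₂ b ≤ T₁.dist r₁ a := by
  induction hk : T₁.dist r₁ a using Nat.strong_induction_on generalizing a b with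
  | _ k ih =>
    by_cases ha : a = r₁
    · subst ha
      obtain rfl : b = r₂ := f₂.injective (hab.symm.trans hr)
      simp
    · obtain ⟨a', b', hab', ha', hb'⟩ := h.exists_parent h₁ hr hab ha
      have h₃ := ih _ (by have := ha'.2; omega) hab' rfl
      have h₄ := h₂.connected.dist_triangle (u := r₂) (v := b') (w := b)
      have h₅ : T₂.dist b' b = 1 := dist_eq_one_iff_adj.2 hb'.symm
      have := ha'.2
      omega

lemma IsAmalgam.exists_near_of_walk (h : IsAmalgam T₁ T₂ A f₁ f₂) {z z' : W} (p : A.Walk z z')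
    {a : V₁} (ha : f₁ a = z) (hz' : z' ∈ Set.range ⇑f₁ ∩ Set.range ⇑f₂) :
    ∃ s t, f₁ s = f₂ t ∧ ∃ q : T₁.Walk a s, q.length ≤ p.length := by
  induction p generalizing a with
  | nil =>
    obtain ⟨t, ht⟩ := hz'.2
    exact ⟨a, t, ha.trans ht.symm, Walk.nil, le_rfl⟩
  | @cons z y z' hzy p ih =>
    by_cases hz : z ∈ Set.range ⇑f₂
    · obtain ⟨t, ht⟩ := hz
      exact ⟨a, t, ha.trans ht.symm, Walk.nil, by simp⟩
    · obtain ⟨-, c, rfl⟩ := (h.ecover z y hzy).resolve_right fun h' => hz h'.1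
      obtain ⟨s, t, hst, q, hq⟩ := ih rfl hz'
      refine ⟨s, t, hst, Walk.cons (f₁.map_adj_iff.1 (ha ▸ hzy)) q, ?_⟩
      simpa using hq

lemma distToSet_le_coverDist [Finite W] (A : SimpleGraph W) (S : Set W) (w : W) :
    distToSet A w S ≤ coverDist A S :=
  le_csSup (Set.finite_range _).bddAbove ⟨w, rfl⟩

lemma IsAmalgam.exists_near [Finite W] (h : IsAmalgam T₁ T₂ A f₁ f₂) (h₁ : T₁.IsTree)
    (hr : f₁ r₁ = f₂ r₂) (hn : coverDist A (Set.range ⇑f₁ ∩ Set.range ⇑f₂) ≤ n) (a : V₁) :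
    ∃ s t, f₁ s = f₂ t ∧ T₁.dist a s ≤ n := by
  obtain ⟨z', hz', hd⟩ : distToSet A (f₁ a) (Set.range ⇑f₁ ∩ Set.range ⇑f₂) ∈
      A.dist (f₁ a) '' (Set.range ⇑f₁ ∩ Set.range ⇑f₂) :=
    Nat.sInf_mem ⟨_, f₁ r₁, ⟨⟨r₁, rfl⟩, ⟨r₂, hr.symm⟩⟩, rfl⟩
  obtain ⟨s, rfl⟩ := hz'.1
  obtain ⟨p, hp⟩ := ((h₁.connected a s).map f₁.toHom).exists_walk_length_eq_dist
  obtain ⟨s', t', hst, q, hq⟩ := h.exists_near_of_walk p rfl hz'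
  refine ⟨s', t', hst, (SimpleGraph.dist_le q).trans (hq.trans ?_)⟩
  exact (hp.trans hd).le.trans ((distToSet_le_coverDist A _ _).trans hn)

lemma IsAmalgam.isTopDownMatching [Finite W] (h : IsAmalgam T₁ T₂ A f₁ f₂) (h₁ : T₁.IsTree)
    (h₂ : T₂.IsTree) (hr : f₁ r₁ = f₂ r₂)
    (hn : coverDist A (Set.range ⇑f₁ ∩ Set.range ⇑f₂) ≤ n) :
    IsTopDownMatching T₁ r₁ T₂ r₂ r₁ r₂ (fun a b => f₁ a = f₂ b) n where
  root := hr
  mem₁ := by simp [subtreeSet_root]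
  mem₂ := by simp [subtreeSet_root]
  right_unique a b b' hM hM' := f₂.injective (hM.symm.trans hM')
  left_unique a a' b hM hM' := f₁.injective (hM.trans hM'.symm)
  parent a b hM := by
    by_cases ha : a = r₁
    · subst ha
      exact Or.inl ⟨rfl, f₂.injective (hM.symm.trans hr)⟩
    · obtain ⟨a', b', hM', ha', hb'⟩ := h.exists_parent h₁ hr hM ha
      refine Or.inr ⟨a', b', hM', ha', hb', ?_⟩
      have := h.dist_le h₁ h₂ hr hM
      have := h.dist_le h₁ h₂ hr hM'
      have := h.symm.dist_le h₂ h₁ hr.symm hM.symm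
      have := h.symm.dist_le h₂ h₁ hr.symm hM'.symm
      have := ha'.2
      omega
  near₁ a _ := h.exists_near h₁ hr hn a
  near₂ b _ := by
    obtain ⟨t, s, hst, hd⟩ := h.symm.exists_near (n := n) h₂ hr.symm (by rwa [Set.inter_comm]) b
    exact ⟨s, t, hst.symm, hd⟩

/-- The disjoint union of two finite types, glued along a partial bijection. -/
lemma exists_pushout [Finite V₁] [Finite V₂] {M : V₁ → V₂ → Prop}
    (hr : ∀ a b b', M a b → M a b' → b = b') (hl : ∀ a a' b, M a b → M a' b → a = a') :
    ∃ (W : Type) (_ : Finite W) (g₁ : V₁ ↪ W) (g₂ : V₂ ↪ W),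
      Set.range g₁ ∪ Set.range g₂ = Set.univ ∧ ∀ a b, g₁ a = g₂ b ↔ M a b := by
  classical
  obtain ⟨k, ⟨e⟩⟩ := Finite.exists_equiv_fin (V₁ ⊕ {b : V₂ // ∀ a, ¬ M a b})
  let g : V₂ → V₁ ⊕ {b : V₂ // ∀ a, ¬ M a b} := fun b =>
    if h : ∃ a, M a b then Sum.inl h.choose else Sum.inr ⟨b, not_exists.1 h⟩
  have hg : ∀ a b, Sum.inl a = g b ↔ M a b := by
    intro a b
    by_cases h : ∃ a, M a b
    · simp only [g, dif_pos h, Sum.inl.injEq]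
      refine ⟨?_, fun h' => hl _ _ b h' h.choose_spec⟩
      rintro rfl
      exact h.choose_spec
    · simpa [g, dif_neg h] using not_exists.1 h a
  have hinj : Function.Injective g := by
    intro b b' hbb
    by_cases h : ∃ a, M a b
    · obtain ⟨a, ha⟩ := h
      exact hr a b b' ha ((hg a b').1 (((hg a b).2 ha).trans hbb))
    · by_cases h' : ∃ a, M a b'
      · obtain ⟨a, ha⟩ := h'
        exact hr a b b' ((hg a b).1 (((hg a b').2 ha).trans hbb.symm)) ha
      · simpa [g, dif_neg h, dif_neg h'] using hbb
  refine ⟨Fin k, inferInstance, ⟨fun a => e (Sum.inl a), e.injective.comp Sum.inl_injective⟩,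
    ⟨fun b => e (g b), e.injective.comp hinj⟩, ?_, fun a b => ?_⟩
  · refine Set.eq_univ_of_forall fun w => ?_
    obtain ⟨z, rfl⟩ := e.surjective w
    rcases z with a | ⟨b, hb⟩
    · exact Or.inl ⟨a, rfl⟩
    · refine Or.inr ⟨b, ?_⟩
      have : ¬ ∃ a, M a b := not_exists.2 hb
      simp [g, this]
  · rw [← hg a b]
    exact e.injective.eq_iff

namespace IsTopDownMatching

variable {M : V₁ → V₂ → Prop}

lemma adj_of_adj (h : IsTopDownMatching T₁ r₁ T₂ r₂ r₁ r₂ M n) (h₂ : T₂.IsTree)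
    {a a' : V₁} {b b' : V₂} (hM : M a b) (hM' : M a' b') (hb : T₂.Adj b b') : T₁.Adj a a' := by
  have key : ∀ {a a' : V₁} {b b' : V₂}, M a b → M a' b' → IsParent T₂ r₂ b' b →
      T₁.Adj a a' := by
    intro a a' b b' hM hM' hb
    rcases h.parent a b hM with ⟨rfl, rfl⟩ | ⟨c, d, hcd, hc, hd⟩
    · have := hb.2
      simp at this
    · obtain rfl := hb.unique h₂ hd
      obtain rfl := h.left_unique _ _ _ hM' hcd
      exact hc.1
  rcases isParent_or_isParent_of_adj h₂ r₂ hb with hb | hb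
  · exact (key hM' hM hb).symm
  · exact key hM hM' hb

lemma convexIn_domain (h : IsTopDownMatching T₁ r₁ T₂ r₂ r₁ r₂ M n) (h₁ : T₁.IsTree) :
    ConvexIn T₁ {a | ∃ b, M a b} := by
  refine convexIn_of_connected h₁ (connected_induce_of_descent (r := r₁) ⟨r₂, h.root⟩ ?_)
  rintro a ⟨b, hab⟩
  rcases h.parent a b hab with ⟨rfl, -⟩ | ⟨c, d, hcd, hc, -⟩
  · exact Or.inl rfl
  · exact Or.inr ⟨c, ⟨d, hcd⟩, hc⟩

lemma exists_isAmalgam [Finite V₁] [Finite V₂] (h : IsTopDownMatching T₁ r₁ T₂ r₂ r₁ r₂ M n)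
    (h₁ : T₁.IsTree) (h₂ : T₂.IsTree) :
    ∃ (W : Type) (A : SimpleGraph W) (f₁ : T₁ ↪g A) (f₂ : T₂ ↪g A),
      Finite W ∧ IsAmalgam T₁ T₂ A f₁ f₂ ∧ f₁ r₁ = f₂ r₂ ∧
        coverDist A (Set.range ⇑f₁ ∩ Set.range ⇑f₂) ≤ n := by
  obtain ⟨W, hW, g₁, g₂, hcover, hM⟩ := exists_pushout h.right_unique h.left_unique
  let A : SimpleGraph W := T₁.map g₁ ⊔ T₂.map g₂
  have hA : ∀ z z', A.Adj z z' ↔ (∃ a a', T₁.Adj a a' ∧ g₁ a = z ∧ g₁ a' = z') ∨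
      ∃ b b', T₂.Adj b b' ∧ g₂ b = z ∧ g₂ b' = z' := fun z z' => by
    simp only [A, sup_adj, map_adj]
  let f₁ : T₁ ↪g A := ⟨g₁, fun {a a'} => by
    rw [hA]
    refine ⟨?_, fun h' => Or.inl ⟨a, a', h', rfl, rfl⟩⟩
    rintro (⟨c, c', hc, hca, hca'⟩ | ⟨b, b', hb, hba, hba'⟩)
    · rwa [← g₁.injective hca, ← g₁.injective hca']
    · exact h.adj_of_adj h₂ ((hM _ _).1 hba.symm) ((hM _ _).1 hba'.symm) hb⟩
  let f₂ : T₂ ↪g A := ⟨g₂, fun {b b'} => by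
    rw [hA]
    refine ⟨?_, fun h' => Or.inr ⟨b, b', h', rfl, rfl⟩⟩
    rintro (⟨a, a', ha, hab, hab'⟩ | ⟨c, c', hc, hcb, hcb'⟩)
    · exact h.symm.adj_of_adj h₁ ((hM _ _).1 hab) ((hM _ _).1 hab') ha
    · rwa [← g₂.injective hcb, ← g₂.injective hcb']⟩
  have hf : ∀ a b, f₁ a = f₂ b ↔ M a b := hM
  have hS₁ : ⇑f₁ ⁻¹' Set.range ⇑f₂ = {a | ∃ b, M a b} := by
    ext a
    exact exists_congr fun b => eq_comm.trans (hf a b)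
  have hS₂ : ⇑f₂ ⁻¹' Set.range ⇑f₁ = {b | ∃ a, M a b} := by
    ext b
    exact exists_congr fun a => hf a b
  refine ⟨W, A, f₁, f₂, hW, ⟨hcover, fun z z' hz => ?_, ?_, ?_⟩, (hf _ _).2 h.root, ?_⟩
  · rcases (hA z z').1 hz with ⟨a, a', -, ha, ha'⟩ | ⟨b, b', -, hb, hb'⟩
    · exact Or.inl ⟨⟨a, ha⟩, ⟨a', ha'⟩⟩
    · exact Or.inr ⟨⟨b, hb⟩, ⟨b', hb'⟩⟩
  · rw [hS₁]
    exact h.convexIn_domain h₁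
  · rw [hS₂]
    exact h.symm.convexIn_domain h₂
  · refine csSup_le' ?_
    rintro _ ⟨w, rfl⟩
    have hw : w ∈ Set.range g₁ ∪ Set.range g₂ := hcover ▸ Set.mem_univ w
    rcases hw with ⟨a, rfl⟩ | ⟨b, rfl⟩
    · obtain ⟨s, t, hst, hd⟩ := h.near₁ a (by simp [subtreeSet_root])
      obtain ⟨p, hp⟩ := h₁.connected.exists_walk_length_eq_dist a s
      have hs : A.dist (f₁ a) (f₁ s) ∈ A.dist (f₁ a) '' (Set.range ⇑f₁ ∩ Set.range ⇑f₂) :=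
        ⟨f₁ s, ⟨⟨s, rfl⟩, ⟨t, ((hf s t).2 hst).symm⟩⟩, rfl⟩
      refine (Nat.sInf_le hs).trans ?_
      refine le_trans ?_ hd
      rw [← hp, ← Walk.length_map f₁.toHom]
      exact dist_le _
    · obtain ⟨s, t, hst, hd⟩ := h.near₂ b (by simp [subtreeSet_root])
      obtain ⟨p, hp⟩ := h₂.connected.exists_walk_length_eq_dist b t
      have ht : A.dist (f₂ b) (f₂ t) ∈ A.dist (f₂ b) '' (Set.range ⇑f₁ ∩ Set.range ⇑f₂) :=
        ⟨f₂ t, ⟨⟨s, (hf s t).2 hst⟩, ⟨t, rfl⟩⟩, rfl⟩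
      refine (Nat.sInf_le ht).trans ?_
      refine le_trans ?_ hd
      rw [← hp, ← Walk.length_map f₂.toHom]
      exact dist_le _

end IsTopDownMatching

lemma topDownDist_le_iff [Finite V₁] [Finite V₂] (h₁ : T₁.IsTree) (h₂ : T₂.IsTree) :
    topDownDist T₁ r₁ T₂ r₂ ≤ n ↔ ∃ M, IsTopDownMatching T₁ r₁ T₂ r₂ r₁ r₂ M n := by
  constructor
  · intro hn
    obtain ⟨m, M, hM⟩ := IsTopDownMatching.exists_of_finite T₁ r₁ T₂ r₂ r₁ r₂
    obtain ⟨W, A, f₁, f₂, hW, hA, hr, -⟩ := hM.exists_isAmalgam h₁ h₂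
    have hne : {n : ℕ | ∃ (W : Type) (A : SimpleGraph W) (f₁ : T₁ ↪g A) (f₂ : T₂ ↪g A),
        Finite W ∧ IsAmalgam T₁ T₂ A f₁ f₂ ∧ f₁ r₁ = f₂ r₂ ∧
          coverDist A (Set.range ⇑f₁ ∩ Set.range ⇑f₂) = n}.Nonempty :=
      ⟨_, W, A, f₁, f₂, hW, hA, hr, rfl⟩
    obtain ⟨W, A, f₁, f₂, hW, hA, hr, hd⟩ := Nat.sInf_mem hne
    exact ⟨_, hA.isTopDownMatching h₁ h₂ hr (hd.le.trans hn)⟩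
  · rintro ⟨M, hM⟩
    obtain ⟨W, A, f₁, f₂, hW, hA, hr, hd⟩ := hM.exists_isAmalgam h₁ h₂
    refine le_trans (Nat.sInf_le ?_) hd
    exact ⟨W, A, f₁, f₂, hW, hA, hr, rfl⟩

lemma isTopDownMatching_induce_iff (h₁ : T₁.IsTree) (h₂ : T₂.IsTree) {x : V₁} {y : V₂}
    {M : V₁ → V₂ → Prop} (hM₁ : ∀ a b, M a b → a ∈ subtreeSet T₁ r₁ x)
    (hM₂ : ∀ a b, M a b → b ∈ subtreeSet T₂ r₂ y) :
    IsTopDownMatching (T₁.induce (subtreeSet T₁ r₁ x)) ⟨x, mem_subtreeSet_self T₁ r₁ x⟩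
      (T₂.induce (subtreeSet T₂ r₂ y)) ⟨y, mem_subtreeSet_self T₂ r₂ y⟩
      ⟨x, mem_subtreeSet_self T₁ r₁ x⟩ ⟨y, mem_subtreeSet_self T₂ r₂ y⟩
      (fun a b => M a b) n ↔ IsTopDownMatching T₁ r₁ T₂ r₂ x y M n := by
  constructor
  · intro h
    refine ⟨h.root, hM₁, hM₂, fun a b b' hb hb' => ?_, fun a a' b ha ha' => ?_,
      fun a b hab => ?_, fun a ha => ?_, fun b hb => ?_⟩
    · exact congrArg Subtype.val <| h.right_unique ⟨a, hM₁ _ _ hb⟩ ⟨b, hM₂ _ _ hb⟩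
        ⟨b', hM₂ _ _ hb'⟩ hb hb'
    · exact congrArg Subtype.val <| h.left_unique ⟨a, hM₁ _ _ ha⟩ ⟨a', hM₁ _ _ ha'⟩
        ⟨b, hM₂ _ _ ha⟩ ha ha'
    · rcases h.parent ⟨a, hM₁ _ _ hab⟩ ⟨b, hM₂ _ _ hab⟩ hab with
        ⟨ha, hb⟩ | ⟨a', b', hM', ha', hb'⟩
      · exact Or.inl ⟨congrArg Subtype.val ha, congrArg Subtype.val hb⟩
      · exact Or.inr ⟨a', b', hM', (isParent_induce_iff h₁ _ _).1 ha',
          (isParent_induce_iff h₂ _ _).1 hb'⟩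
    · obtain ⟨s, t, hst, hd⟩ := h.near₁ ⟨a, ha⟩ (by simp [subtreeSet_root])
      rw [(convexIn_subtreeSet h₁).dist_induce h₁.connected] at hd
      exact ⟨s, t, hst, hd⟩
    · obtain ⟨s, t, hst, hd⟩ := h.near₂ ⟨b, hb⟩ (by simp [subtreeSet_root])
      rw [(convexIn_subtreeSet h₂).dist_induce h₂.connected] at hd
      exact ⟨s, t, hst, hd⟩
  · intro h
    refine ⟨h.root, by simp [subtreeSet_root], by simp [subtreeSet_root],
      fun a b b' hb hb' => Subtype.ext (h.right_unique _ _ _ hb hb'),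
      fun a a' b ha ha' => Subtype.ext (h.left_unique _ _ _ ha ha'),
      fun a b hab => ?_, fun a _ => ?_, fun b _ => ?_⟩
    · rcases h.parent a b hab with ⟨ha, hb⟩ | ⟨a', b', hM', ha', hb'⟩
      · exact Or.inl ⟨Subtype.ext ha, Subtype.ext hb⟩
      · exact Or.inr ⟨⟨a', hM₁ _ _ hM'⟩, ⟨b', hM₂ _ _ hM'⟩, hM',
          (isParent_induce_iff h₁ _ _).2 ha', (isParent_induce_iff h₂ _ _).2 hb'⟩
    · obtain ⟨s, t, hst, hd⟩ := h.near₁ a a.2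
      refine ⟨⟨s, hM₁ _ _ hst⟩, ⟨t, hM₂ _ _ hst⟩, hst, ?_⟩
      rwa [(convexIn_subtreeSet h₁).dist_induce h₁.connected]
    · obtain ⟨s, t, hst, hd⟩ := h.near₂ b b.2
      refine ⟨⟨s, hM₁ _ _ hst⟩, ⟨t, hM₂ _ _ hst⟩, hst, ?_⟩
      rwa [(convexIn_subtreeSet h₂).dist_induce h₂.connected]

theorem subtreeDist_le_iff [Finite V₁] [Finite V₂] (h₁ : T₁.IsTree) (h₂ : T₂.IsTree)
    (x : V₁) (y : V₂) :
    subtreeDist T₁ r₁ T₂ r₂ x y ≤ n ↔ ∃ M, IsTopDownMatching T₁ r₁ T₂ r₂ x y M n := by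
  unfold subtreeDist
  rw [topDownDist_le_iff (isTree_induce_subtreeSet h₁) (isTree_induce_subtreeSet h₂)]
  constructor
  · rintro ⟨M, hM⟩
    refine ⟨fun a b => ∃ (ha : a ∈ subtreeSet T₁ r₁ x) (hb : b ∈ subtreeSet T₂ r₂ y),
      M ⟨a, ha⟩ ⟨b, hb⟩, (isTopDownMatching_induce_iff h₁ h₂ ?_ ?_).1 ?_⟩
    · rintro a b ⟨ha, -, -⟩
      exact ha
    · rintro a b ⟨-, hb, -⟩
      exact hb
    · convert hM with a b
      simp
  · rintro ⟨M, hM⟩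
    exact ⟨_, (isTopDownMatching_induce_iff h₁ h₂ hM.mem₁ hM.mem₂).2 hM⟩

end Amalgam

/-- for non-leaf vertices `v` of `(T₁, r₁)` and `u` of `(T₂, r₂)` with at
least as many children of `v` as of `u`, the optimal top-down amalgam distance
`D(v, u)` of the subtrees rooted at `v` and `u` is the minimum over all injections `f`
from the children of `u` into the children of `v` of the maximum of the values
`D(f(uⱼ), uⱼ)` together with `height(vᵢ) + 1` for the children `vᵢ` of `v` outside the
image of `f`. -/
theorem subtreeDist_eq_min_over_injections
    {V₁ V₂ : Type*} [Fintype V₁] [Fintype V₂]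
    (T₁ : SimpleGraph V₁) (r₁ : V₁) (T₂ : SimpleGraph V₂) (r₂ : V₂)
    (h₁ : T₁.IsTree) (h₂ : T₂.IsTree)
    (v : V₁) (u : V₂)
    (hv : (childSet T₁ r₁ v).Nonempty) (hu : (childSet T₂ r₂ u).Nonempty)
    (hpq : (childSet T₂ r₂ u).ncard ≤ (childSet T₁ r₁ v).ncard) :
    subtreeDist T₁ r₁ T₂ r₂ v u =
      sInf {n : ℕ | ∃ f : ↥(childSet T₂ r₂ u) → ↥(childSet T₁ r₁ v),
        Function.Injective f ∧
        n = sSup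
          ((Set.range fun j : ↥(childSet T₂ r₂ u) =>
              subtreeDist T₁ r₁ T₂ r₂ (↑(f j)) (↑j)) ∪
            ((fun i : ↥(childSet T₁ r₁ v) => heightV T₁ r₁ (↑i) + 1) ''
              (Set.range f)ᶜ))} := by
  have hne : ∃ f : childSet T₂ r₂ u → childSet T₁ r₁ v, Function.Injective f := by
    obtain ⟨f, hf, -⟩ := exists_injective_extending
      (α := childSet T₂ r₂ u) (β := childSet T₁ r₁ v) hpq (R := fun _ _ => False)
      (by simp) (by simp)
    exact ⟨f, hf⟩
  have hfin : ∀ f : childSet T₂ r₂ u → childSet T₁ r₁ v,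
      ((Set.range fun j : childSet T₂ r₂ u => subtreeDist T₁ r₁ T₂ r₂ (f j) j) ∪
        (fun i : childSet T₁ r₁ v => heightV T₁ r₁ i + 1) '' (Set.range f)ᶜ).Finite :=
    fun f => (Set.finite_range _).union (Set.toFinite _)
  refine eq_of_forall_ge_iff fun n => ?_
  rw [subtreeDist_le_iff h₁ h₂, exists_isTopDownMatching_iff h₁ h₂ hpq]
  constructor
  · rintro ⟨f, hf, hD, hH⟩
    refine le_trans (Nat.sInf_le ⟨f, hf, rfl⟩) (csSup_le' ?_)
    rintro _ (⟨j, rfl⟩ | ⟨i, hi, rfl⟩)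
    · exact (subtreeDist_le_iff h₁ h₂ _ _).2 (hD j)
    · exact hH i hi
  · intro hn
    obtain ⟨f₀, hf₀⟩ := hne
    obtain ⟨f, hf, hs⟩ := Nat.sInf_mem (s := {n : ℕ | ∃ f : ↥(childSet T₂ r₂ u) →
      ↥(childSet T₁ r₁ v), Function.Injective f ∧ n = sSup
        ((Set.range fun j : ↥(childSet T₂ r₂ u) => subtreeDist T₁ r₁ T₂ r₂ (↑(f j)) (↑j)) ∪
          ((fun i : ↥(childSet T₁ r₁ v) => heightV T₁ r₁ (↑i) + 1) '' (Set.range f)ᶜ))})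
      ⟨_, f₀, hf₀, rfl⟩
    rw [hs] at hn
    refine ⟨f, hf, fun j => (subtreeDist_le_iff h₁ h₂ _ _).1 ?_, fun i hi => ?_⟩
    · exact (le_csSup (hfin f).bddAbove (Or.inl ⟨j, rfl⟩)).trans hn
    · exact (le_csSup (hfin f).bddAbove (Or.inr ⟨i, hi, rfl⟩)).trans hn

end HDTrees
end
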